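/- arXiv:1112.4226 — 2 statements merged into one kernel-verified Lean document; each statement's English description precedes it below -/
import Mathlib

section
/- Large-argument asymptotics of the Whittaker function: let μ, ν ∈ ℂ with Re ν > 0 and μ + ν + 1/2 not a nonpositive integer. Then W_{μ,ν}(y) / (y^μ e^{−y/2}) tends to 1 as y → +∞ (where y^μ is defined via the real logarithm of y). -/
open MeasureTheory

/-- The Whittaker function W_{μ,ν}(y), defined for Re ν > 0, μ + ν + 1/2 not a nonpositive
integer and y > 0 by the absolutely convergent integral
W_{μ,ν}(y) = e^{iπμ} Γ(μ+ν+1/2) π^{−1} (y/4)^{1/2−ν}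
  ∫ e^{−iyξ/2} (ξ²+1)^{−ν−1/2} exp(μ(Log(ξ−i) − Log(ξ+i))) dξ. -/
noncomputable def Wh (μ ν : ℂ) (y : ℝ) : ℂ :=
  Complex.exp (Complex.I * (Real.pi : ℂ) * μ) * Complex.Gamma (μ + ν + 1 / 2) / (Real.pi : ℂ) *
    ((y / 4 : ℝ) : ℂ) ^ ((1 : ℂ) / 2 - ν) *
    ∫ ξ : ℝ,
      Complex.exp (-Complex.I * (y : ℂ) * (ξ : ℂ) / 2) *
        ((ξ ^ 2 + 1 : ℝ) : ℂ) ^ (-ν - 1 / 2) *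
        Complex.exp (μ * (Complex.log ((ξ : ℂ) - Complex.I) - Complex.log ((ξ : ℂ) + Complex.I)))

open Complex Filter Set Topology

section GammaIntegral

theorem integrableOn_rpow_mul_exp_neg_mul {s r : ℝ} (hs : 0 < s) (hr : 0 < r) :
    IntegrableOn (fun t : ℝ => t ^ (s - 1) * Real.exp (-(r * t))) (Ioi 0) := by
  have h := integrableOn_rpow_mul_exp_neg_mul_rpow (p := 1) (s := s - 1) (b := r)
    (by linarith) one_pos hr
  simpa [neg_mul] using h

theorem aestronglyMeasurable_cpow_mul_exp (a r : ℂ) :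
    AEStronglyMeasurable (fun t : ℝ => (t : ℂ) ^ (a - 1) * cexp (-(r * t)))
      (volume.restrict (Ioi 0)) := by
  refine ContinuousOn.aestronglyMeasurable ?_ measurableSet_Ioi
  intro t ht
  refine ContinuousAt.continuousWithinAt ?_
  have h : (t : ℂ) ∈ slitPlane := Or.inl (by simpa using ht)
  have h1 : ContinuousAt (fun t : ℝ => (t : ℂ) ^ (a - 1)) t :=
    (continuous_ofReal.continuousAt).cpow continuousAt_const h
  exact h1.mul (by fun_prop)

theorem norm_cpow_mul_exp (a r : ℂ) {t : ℝ} (ht : 0 < t) :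
    ‖(t : ℂ) ^ (a - 1) * cexp (-(r * t))‖ = t ^ (a.re - 1) * Real.exp (-(r.re * t)) := by
  rw [norm_mul, norm_cpow_eq_rpow_re_of_pos ht, Complex.norm_exp]
  simp

theorem integrableOn_cpow_mul_exp_neg_mul {a r : ℂ} (ha : 0 < a.re) (hr : 0 < r.re) :
    IntegrableOn (fun t : ℝ => (t : ℂ) ^ (a - 1) * cexp (-(r * t))) (Ioi 0) := by
  refine (integrableOn_rpow_mul_exp_neg_mul ha hr).mono' (aestronglyMeasurable_cpow_mul_exp a r) ?_
  filter_upwards [ae_restrict_mem measurableSet_Ioi] with t ht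
  exact (norm_cpow_mul_exp a r ht).le

theorem differentiableOn_gammaIntegral_mul {a : ℂ} (ha : 0 < a.re) :
    DifferentiableOn ℂ (fun r : ℂ => ∫ t : ℝ in Ioi 0, (t : ℂ) ^ (a - 1) * cexp (-(r * t)))
      {r : ℂ | 0 < r.re} := by
  intro r hr
  have hr' : 0 < r.re := hr
  have hs : {z : ℂ | r.re / 2 < z.re} ∈ 𝓝 r :=
    (isOpen_lt continuous_const continuous_re).mem_nhds (by simpa using hr')
  have key := hasDerivAt_integral_of_dominated_loc_of_deriv_le
    (μ := volume.restrict (Ioi (0 : ℝ))) (x₀ := r)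
    (F := fun (r : ℂ) (t : ℝ) => (t : ℂ) ^ (a - 1) * cexp (-(r * t)))
    (F' := fun (r : ℂ) (t : ℝ) => -((t : ℂ) ^ (a + 1 - 1) * cexp (-(r * t))))
    (bound := fun t => t ^ ((a.re + 1) - 1) * Real.exp (-(r.re / 2 * t))) hs
    (Eventually.of_forall fun z => aestronglyMeasurable_cpow_mul_exp a z)
    (integrableOn_cpow_mul_exp_neg_mul ha hr')
    (aestronglyMeasurable_cpow_mul_exp (a + 1) r).neg ?_
    (integrableOn_rpow_mul_exp_neg_mul (by linarith) (by linarith)) ?_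
  · exact key.2.differentiableAt.differentiableWithinAt
  · filter_upwards [ae_restrict_mem measurableSet_Ioi] with t ht z hz
    have ht' : 0 < t := ht
    have hz' : r.re / 2 < z.re := hz
    rw [norm_neg, norm_cpow_mul_exp _ _ ht, add_re, one_re]
    gcongr
  · filter_upwards [ae_restrict_mem measurableSet_Ioi] with t ht z _
    have ht0 : (t : ℂ) ≠ 0 := ofReal_ne_zero.2 (ne_of_gt ht)
    have h1 : HasDerivAt (fun z : ℂ => -(z * t)) (-(1 * (t : ℂ))) z :=
      ((hasDerivAt_id z).mul_const (t : ℂ)).neg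
    convert! h1.cexp.const_mul ((t : ℂ) ^ (a - 1)) using 1
    rw [show a + 1 - 1 = a - 1 + 1 by ring, cpow_add _ _ ht0, cpow_one]
    ring

/-- The Laplace transform of a complex power, at a complex argument of positive real part. -/
theorem integral_cpow_mul_exp_neg_mul_of_re_pos {a r : ℂ} (ha : 0 < a.re) (hr : 0 < r.re) :
    ∫ t : ℝ in Ioi 0, (t : ℂ) ^ (a - 1) * cexp (-(r * t)) = r ^ (-a) * Complex.Gamma a := by
  have hopen : IsOpen {z : ℂ | 0 < z.re} := isOpen_lt continuous_const continuous_re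
  refine AnalyticOnNhd.eqOn_of_preconnected_of_frequently_eq (z₀ := 1)
    ((differentiableOn_gammaIntegral_mul ha).analyticOnNhd hopen)
    (DifferentiableOn.analyticOnNhd (f := fun r : ℂ => r ^ (-a) * Complex.Gamma a) ?_ hopen)
    (convex_halfSpace_re_gt 0).isPreconnected (by simp) ?_ hr
  · intro z hz
    exact ((differentiableAt_id.cpow_const (Or.inl hz)).mul_const _).differentiableWithinAt
  · have ht : Tendsto (fun x : ℝ => (x : ℂ)) (𝓝[>] 1) (𝓝[≠] 1) := by
      refine tendsto_nhdsWithin_iff.2 ⟨?_, ?_⟩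
      · exact (continuous_ofReal.tendsto' 1 1 (by simp)).mono_left nhdsWithin_le_nhds
      · filter_upwards [self_mem_nhdsWithin] with x hx
        have : x ≠ 1 := ne_of_gt hx
        simpa using this
    refine ht.frequently (Eventually.frequently ?_)
    filter_upwards [self_mem_nhdsWithin] with x hx
    have hx0 : 0 < x := lt_trans one_pos hx
    rw [Complex.integral_cpow_mul_exp_neg_mul_Ioi ha hx0, one_div, inv_cpow, cpow_neg]
    rw [arg_ofReal_of_nonneg hx0.le]
    exact Real.pi_pos.ne

end GammaIntegral

section Kernel

/-- The function `(1 - iξ)^(-a) (1 + iξ)^(-b)` of a real variable `ξ`. -/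
noncomputable def imagPowKernel (a b : ℂ) (ξ : ℝ) : ℂ :=
  (1 - I * ξ) ^ (-a) * (1 + I * ξ) ^ (-b)

/-- The Fourier integral `∫ e^(-ipξ) (1 - iξ)^(-a) (1 + iξ)^(-b) dξ`. -/
noncomputable def imagPowIntegral (a b : ℂ) (p : ℝ) : ℂ :=
  ∫ ξ : ℝ, cexp (-(I * p * ξ)) * imagPowKernel a b ξ

theorem one_sub_I_mul_mem_slitPlane (ξ : ℝ) : (1 - I * ξ : ℂ) ∈ slitPlane := Or.inl (by simp)

theorem one_add_I_mul_mem_slitPlane (ξ : ℝ) : (1 + I * ξ : ℂ) ∈ slitPlane := Or.inl (by simp)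

theorem one_sub_I_mul_ne_zero (ξ : ℝ) : (1 - I * ξ : ℂ) ≠ 0 :=
  slitPlane_ne_zero (one_sub_I_mul_mem_slitPlane ξ)

theorem one_add_I_mul_ne_zero (ξ : ℝ) : (1 + I * ξ : ℂ) ≠ 0 :=
  slitPlane_ne_zero (one_add_I_mul_mem_slitPlane ξ)

theorem norm_one_add_I_mul (ξ : ℝ) : ‖(1 + I * ξ : ℂ)‖ = (1 + ξ ^ 2) ^ (1 / 2 : ℝ) := by
  rw [← Real.sqrt_eq_rpow, mul_comm, ← ofReal_one, norm_add_mul_I, one_pow]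

theorem norm_one_sub_I_mul (ξ : ℝ) : ‖(1 - I * ξ : ℂ)‖ = (1 + ξ ^ 2) ^ (1 / 2 : ℝ) := by
  simpa [sub_eq_add_neg] using norm_one_add_I_mul (-ξ)

theorem norm_exp_neg_I_mul (p ξ : ℝ) : ‖cexp (-(I * p * ξ))‖ = 1 := by
  rw [Complex.norm_exp]; simp

theorem hasDerivAt_imagPowKernel (a b : ℂ) (ξ : ℝ) :
    HasDerivAt (imagPowKernel a b)
      (I * a * imagPowKernel (a + 1) b ξ - I * b * imagPowKernel a (b + 1) ξ) ξ := by
  have hI : HasDerivAt (fun x : ℝ => I * (x : ℂ)) I ξ := by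
    simpa using (hasDerivAt_id ξ).ofReal_comp.const_mul I
  have h1 := (((hasDerivAt_id (1 - I * ξ : ℂ)).cpow_const (c := -a)
    (one_sub_I_mul_mem_slitPlane ξ)).comp_of_eq ξ (hI.const_sub 1) rfl)
  have h2 := (((hasDerivAt_id (1 + I * ξ : ℂ)).cpow_const (c := -b)
    (one_add_I_mul_mem_slitPlane ξ)).comp_of_eq ξ (hI.const_add 1) rfl)
  refine (h1.mul h2).congr_deriv ?_
  simp only [imagPowKernel, neg_add, sub_eq_add_neg, Function.comp_apply, id]
  ring

theorem continuous_imagPowKernel (a b : ℂ) : Continuous (imagPowKernel a b) :=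
  continuous_iff_continuousAt.2 fun ξ => (hasDerivAt_imagPowKernel a b ξ).continuousAt

theorem exp_neg_arg_mul_le (z : ℂ) (x : ℝ) :
    (Real.exp (z.arg * x))⁻¹ ≤ Real.exp (Real.pi * |x|) := by
  rw [← Real.exp_neg, Real.exp_le_exp]
  calc -(z.arg * x) ≤ |z.arg * x| := neg_le_abs _
    _ = |z.arg| * |x| := abs_mul _ _
    _ ≤ _ := by gcongr; exact abs_arg_le_pi z

theorem norm_imagPowKernel_le (a b : ℂ) (ξ : ℝ) :
    ‖imagPowKernel a b ξ‖ ≤ Real.exp (Real.pi * |(-a).im|) * Real.exp (Real.pi * |(-b).im|) *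
      (1 + ‖ξ‖ ^ 2) ^ (-(a + b).re / 2) := by
  have h0 : (0 : ℝ) < 1 + ξ ^ 2 := by positivity
  rw [imagPowKernel, norm_mul, norm_cpow_of_ne_zero (one_sub_I_mul_ne_zero ξ),
    norm_cpow_of_ne_zero (one_add_I_mul_ne_zero ξ), norm_one_add_I_mul, norm_one_sub_I_mul,
    ← Real.rpow_mul h0.le, ← Real.rpow_mul h0.le, Real.norm_eq_abs, sq_abs,
    show -(a + b).re / 2 = 1 / 2 * (-a).re + 1 / 2 * (-b).re by simp; ring, Real.rpow_add h0]
  calc _ = ((Real.exp ((1 - I * ξ : ℂ).arg * (-a).im))⁻¹ *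
        (Real.exp ((1 + I * ξ : ℂ).arg * (-b).im))⁻¹) *
        ((1 + ξ ^ 2) ^ (1 / 2 * (-a).re) * (1 + ξ ^ 2) ^ (1 / 2 * (-b).re)) := by ring
    _ ≤ _ := by
      refine mul_le_mul_of_nonneg_right ?_ (by positivity)
      gcongr <;> exact exp_neg_arg_mul_le _ _

theorem integrable_imagPowKernel {a b : ℂ} (h : 1 < (a + b).re) :
    Integrable (imagPowKernel a b) := by
  have hi := integrable_rpow_neg_one_add_norm_sq (E := ℝ) (μ := volume) (r := (a + b).re)
    (by simpa using h)
  exact (hi.const_mul _).mono' (continuous_imagPowKernel a b).aestronglyMeasurable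
    (Eventually.of_forall (norm_imagPowKernel_le a b))

theorem integrable_exp_mul_imagPowKernel {a b : ℂ} (h : 1 < (a + b).re) (p : ℝ) :
    Integrable fun ξ : ℝ => cexp (-(I * p * ξ)) * imagPowKernel a b ξ :=
  (integrable_imagPowKernel h).bdd_mul (c := 1)
    (Continuous.aestronglyMeasurable (by fun_prop))
    (Eventually.of_forall fun ξ => (norm_exp_neg_I_mul p ξ).le)

theorem imagPowKernel_add_imagPowKernel (a b : ℂ) (ξ : ℝ) :
    imagPowKernel a (b + 1) ξ + imagPowKernel (a + 1) b ξ =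
      2 * imagPowKernel (a + 1) (b + 1) ξ := by
  have h1 := one_sub_I_mul_ne_zero ξ
  have h2 := one_add_I_mul_ne_zero ξ
  simp only [imagPowKernel, neg_add]
  rw [cpow_add _ _ h1, cpow_add _ _ h2, cpow_neg_one, cpow_neg_one]
  field_simp
  ring

theorem imagPowIntegral_add_imagPowIntegral {a b : ℂ} (h : 0 < (a + b).re) (p : ℝ) :
    imagPowIntegral a (b + 1) p + imagPowIntegral (a + 1) b p =
      2 * imagPowIntegral (a + 1) (b + 1) p := by
  simp only [add_re] at h
  rw [imagPowIntegral, imagPowIntegral, imagPowIntegral, ← integral_add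
    (integrable_exp_mul_imagPowKernel (by simp; linarith) p)
    (integrable_exp_mul_imagPowKernel (by simp; linarith) p), ← integral_const_mul]
  refine integral_congr_ae (Eventually.of_forall fun ξ => ?_)
  simp only
  rw [← mul_add, imagPowKernel_add_imagPowKernel]
  ring

theorem mul_imagPowIntegral {a b : ℂ} (h : 1 < (a + b).re) (p : ℝ) :
    p * imagPowIntegral a b p =
      a * imagPowIntegral (a + 1) b p - b * imagPowIntegral a (b + 1) p := by
  simp only [add_re] at h
  have i0 := integrable_exp_mul_imagPowKernel (a := a) (b := b) (by simpa using h) p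
  have i1 := integrable_exp_mul_imagPowKernel (a := a + 1) (b := b) (by simp; linarith) p
  have i2 := integrable_exp_mul_imagPowKernel (a := a) (b := b + 1) (by simp; linarith) p
  have hu : ∀ x : ℝ, HasDerivAt (fun x : ℝ => cexp (-(I * p * x)))
      (-(I * p) * cexp (-(I * p * x))) x := fun x => by
    have h1 : HasDerivAt (fun x : ℝ => -(I * p * (x : ℂ))) (-(I * p)) x := by
      simpa using ((hasDerivAt_id x).ofReal_comp.const_mul (I * p)).fun_neg
    convert! h1.cexp using 1
    ring
  have key := integral_mul_deriv_eq_deriv_mul_of_integrable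
    (u := fun x : ℝ => cexp (-(I * p * x))) (v := imagPowKernel a b)
    (fun x _ => hu x) (fun x _ => hasDerivAt_imagPowKernel a b x)
    (((i1.const_mul (I * a)).sub (i2.const_mul (I * b))).congr
      (Eventually.of_forall fun x => by simp; ring))
    ((i0.const_mul (-(I * p))).congr (Eventually.of_forall fun x => by simp; ring)) i0
  have hl : ∫ x : ℝ, cexp (-(I * p * x)) *
      (I * a * imagPowKernel (a + 1) b x - I * b * imagPowKernel a (b + 1) x) =
      I * a * imagPowIntegral (a + 1) b p - I * b * imagPowIntegral a (b + 1) p := by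
    rw [imagPowIntegral, imagPowIntegral, ← integral_const_mul, ← integral_const_mul,
      ← integral_sub (i1.const_mul _) (i2.const_mul _)]
    congr 1; ext x; ring
  have hr : ∫ x : ℝ, -(I * p) * cexp (-(I * p * x)) * imagPowKernel a b x =
      -(I * p) * imagPowIntegral a b p := by
    rw [imagPowIntegral, ← integral_const_mul]
    congr 1; ext x; ring
  rw [hl, hr] at key
  refine mul_left_cancel₀ I_ne_zero ?_
  linear_combination -key

end Kernel

section FourierInversion

open FourierTransform

theorem fourierInv_indicator_cpow_mul_exp {a : ℂ} (ha : 0 < a.re) (w : ℝ) :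
    𝓕⁻ (indicator (Ioi 0) fun t : ℝ => (t : ℂ) ^ (a - 1) * cexp (-(1 * t))) w =
      imagPowKernel a 0 (2 * Real.pi * w) * Complex.Gamma a := by
  have hr : 0 < (1 - I * (2 * Real.pi * w : ℝ) : ℂ).re := by simp
  rw [Real.fourierInv_eq', imagPowKernel, neg_zero, cpow_zero, mul_one,
    ← integral_cpow_mul_exp_neg_mul_of_re_pos ha hr, ← integral_indicator measurableSet_Ioi]
  congr 1
  ext t
  by_cases ht : t ∈ Ioi (0 : ℝ)
  · rw [indicator_of_mem ht, indicator_of_mem ht, smul_eq_mul, mul_left_comm, ← Complex.exp_add]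
    congr 2
    simp
    ring
  · rw [indicator_of_notMem ht, indicator_of_notMem ht, smul_zero]

theorem integral_exp_mul_imagPowKernel_zero {a : ℂ} (ha : 1 < a.re) {t : ℝ} (ht : 0 < t) :
    ∫ ξ : ℝ, cexp (-(I * t * ξ)) * imagPowKernel a 0 ξ =
      2 * Real.pi * (Complex.Gamma a)⁻¹ * ((t : ℂ) ^ (a - 1) * cexp (-t)) := by
  have ha0 : 0 < a.re := by linarith
  have hG : Complex.Gamma a ≠ 0 := Complex.Gamma_ne_zero_of_re_pos ha0
  have hpi : (Real.pi : ℂ) ≠ 0 := ofReal_ne_zero.2 Real.pi_ne_zero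
  set f : ℝ → ℂ := indicator (Ioi 0) fun t : ℝ => (t : ℂ) ^ (a - 1) * cexp (-(1 * t)) with hf
  have hfi : Integrable f :=
    (integrable_indicator_iff measurableSet_Ioi).2
      (integrableOn_cpow_mul_exp_neg_mul ha0 (by simp))
  have hker : Integrable (imagPowKernel a 0) := integrable_imagPowKernel (by simpa using ha)
  have hinv : 𝓕⁻ f = fun w => imagPowKernel a 0 (2 * Real.pi * w) * Complex.Gamma a :=
    funext fun w => fourierInv_indicator_cpow_mul_exp ha0 w
  have hFi : Integrable (𝓕 f) := by
    have h1 : Integrable (𝓕⁻ f) := by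
      rw [hinv]
      exact (hker.comp_mul_left' (R := 2 * Real.pi) (by positivity)).mul_const _
    refine h1.comp_neg.congr (Eventually.of_forall fun w => ?_)
    simp [Real.fourierInv_eq_fourier_neg]
  have hft : f t = (t : ℂ) ^ (a - 1) * cexp (-t) := by
    rw [hf, indicator_of_mem (show t ∈ Ioi (0 : ℝ) from ht), one_mul]
  have hcont : ContinuousAt f t := by
    have h1 : ContinuousAt (fun t : ℝ => (t : ℂ) ^ (a - 1) * cexp (-(1 * t))) t :=
      ((continuous_ofReal.continuousAt).cpow continuousAt_const
        (Or.inl (by simpa using ht))).mul (by fun_prop)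
    refine h1.congr ?_
    filter_upwards [Ioi_mem_nhds ht] with s hs
    rw [hf, indicator_of_mem hs]
  have key := hfi.fourier_fourierInv_eq hFi hcont
  rw [Real.fourier_real_eq_integral_exp_smul, hinv, hft] at key
  have hsub := Measure.integral_comp_mul_left
    (fun ξ : ℝ => cexp (-(I * t * ξ)) * imagPowKernel a 0 ξ) (2 * Real.pi)
  have hpos : (0 : ℝ) < (2 * Real.pi)⁻¹ := by positivity
  have hlhs : ∫ w : ℝ, cexp (((-2 * Real.pi * w * t : ℝ) : ℂ) * I) •
      (imagPowKernel a 0 (2 * Real.pi * w) * Complex.Gamma a) =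
      (∫ w : ℝ, cexp (-(I * t * (2 * Real.pi * w : ℝ))) * imagPowKernel a 0 (2 * Real.pi * w)) *
        Complex.Gamma a := by
    rw [← integral_mul_const]
    congr 1
    ext w
    rw [smul_eq_mul, ← mul_assoc]
    congr 3
    push_cast
    ring
  rw [hlhs, hsub, abs_of_pos hpos, real_smul] at key
  rw [← key]
  push_cast
  field_simp

theorem imagPowIntegral_eq_integral_Ioi {a b : ℂ} (ha : 1 < a.re) (hb : 0 < b.re) {p : ℝ}
    (hp : 0 < p) :
    imagPowIntegral a b p = 2 * Real.pi * (Complex.Gamma a)⁻¹ * (Complex.Gamma b)⁻¹ *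
      ∫ s : ℝ in Ioi 0, (s : ℂ) ^ (b - 1) * (((s + p : ℝ) : ℂ) ^ (a - 1) * cexp (-(2 * s + p))) := by
  have hG : Complex.Gamma b ≠ 0 := Complex.Gamma_ne_zero_of_re_pos hb
  have hker : Integrable (imagPowKernel a 0) := integrable_imagPowKernel (by simpa using ha)
  have h_integrand : Integrable (Function.uncurry fun (ξ s : ℝ) =>
      cexp (-(I * (s + p : ℝ) * ξ)) *
        (imagPowKernel a 0 ξ * ((s : ℂ) ^ (b - 1) * cexp (-(1 * s)))))
      (volume.prod (volume.restrict (Ioi 0))) := by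
    refine Integrable.bdd_mul (c := 1)
      (hker.mul_prod (integrableOn_cpow_mul_exp_neg_mul (r := 1) hb (by simp))) ?_ ?_
    · exact Continuous.aestronglyMeasurable (by fun_prop)
    · exact Eventually.of_forall fun z => (norm_exp_neg_I_mul (z.2 + p) z.1).le
  have hleft : Complex.Gamma b * imagPowIntegral a b p =
      ∫ ξ : ℝ, ∫ s : ℝ in Ioi 0, cexp (-(I * (s + p : ℝ) * ξ)) *
        (imagPowKernel a 0 ξ * ((s : ℂ) ^ (b - 1) * cexp (-(1 * s)))) := by
    rw [imagPowIntegral, ← integral_const_mul]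
    congr 1
    ext ξ
    have h := integral_cpow_mul_exp_neg_mul_of_re_pos (r := 1 + I * ξ) hb (by simp)
    calc _ = cexp (-(I * p * ξ)) * imagPowKernel a 0 ξ *
          ((1 + I * ξ) ^ (-b) * Complex.Gamma b) := by
          simp only [imagPowKernel, neg_zero, cpow_zero]; ring
      _ = _ := by
        rw [← h, ← integral_const_mul]
        congr 1
        ext s
        have he : cexp (-(I * p * ξ)) * cexp (-((1 + I * ξ) * s)) =
            cexp (-(I * (s + p : ℝ) * ξ)) * cexp (-(1 * s)) := by
          rw [← Complex.exp_add, ← Complex.exp_add]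
          congr 1
          push_cast
          ring
        linear_combination (imagPowKernel a 0 ξ * (s : ℂ) ^ (b - 1)) * he
  have hright : ∫ s : ℝ in Ioi 0, ∫ ξ : ℝ, cexp (-(I * (s + p : ℝ) * ξ)) *
        (imagPowKernel a 0 ξ * ((s : ℂ) ^ (b - 1) * cexp (-(1 * s)))) =
      2 * Real.pi * (Complex.Gamma a)⁻¹ *
        ∫ s : ℝ in Ioi 0,
          (s : ℂ) ^ (b - 1) * (((s + p : ℝ) : ℂ) ^ (a - 1) * cexp (-(2 * s + p))) := by
    rw [← integral_const_mul]
    refine setIntegral_congr_fun measurableSet_Ioi fun s hs => ?_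
    have hs0 : 0 < s := hs
    have h := integral_exp_mul_imagPowKernel_zero ha (show 0 < s + p by positivity)
    simp only [← mul_assoc] at h ⊢
    rw [integral_mul_const, integral_mul_const, h]
    have he : cexp (-(2 * s + p)) = cexp (-(s + p : ℝ)) * cexp (-(1 * s)) := by
      rw [← Complex.exp_add]
      congr 1
      push_cast
      ring
    rw [he]
    ring
  rw [integral_integral_swap h_integrand, hright] at hleft
  rw [mul_right_comm, ← hleft]
  field_simp

end FourierInversion

section Asymptotics

/-- The leading asymptotics `2π 2^(-b) / Γ(a) · p^(a-1) e^(-p)` of `imagPowIntegral a b p`. -/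
def HasImagPowAsymptotics (a b : ℂ) : Prop :=
  Tendsto (fun p : ℝ => imagPowIntegral a b p * (cexp p * (p : ℂ) ^ (1 - a))) atTop
    (𝓝 (2 * Real.pi * 2 ^ (-b) * (Complex.Gamma a)⁻¹))

theorem tendsto_integral_cpow_mul_one_add_div {a b : ℂ} (ha : 1 < a.re) (hb : 0 < b.re) :
    Tendsto (fun p : ℝ => ∫ s : ℝ in Ioi 0,
      (s : ℂ) ^ (b - 1) * cexp (-(2 * s)) * ((1 + s / p : ℝ) : ℂ) ^ (a - 1)) atTop
      (𝓝 (2 ^ (-b) * Complex.Gamma b)) := by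
  rw [← integral_cpow_mul_exp_neg_mul_of_re_pos hb (show 0 < (2 : ℂ).re by simp)]
  refine tendsto_integral_filter_of_dominated_convergence
    (fun s => s ^ (b.re - 1) * Real.exp (-(1 * s))) ?_ ?_
    (integrableOn_rpow_mul_exp_neg_mul hb one_pos) ?_
  · filter_upwards [eventually_gt_atTop 0] with p hp
    refine (aestronglyMeasurable_cpow_mul_exp b 2).mul
      (ContinuousOn.aestronglyMeasurable (fun s hs => ?_) measurableSet_Ioi)
    have hs0 : 0 < s := hs
    have h1 : 0 < 1 + s / p := by positivity
    exact (ContinuousAt.cpow (by fun_prop) continuousAt_const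
      (Or.inl (by rwa [ofReal_re]))).continuousWithinAt
  · filter_upwards [eventually_gt_atTop 0, eventually_ge_atTop (a.re - 1)] with p hp hpa
    filter_upwards [ae_restrict_mem measurableSet_Ioi] with s hs
    have hs0 : 0 < s := hs
    have h1 : 0 < 1 + s / p := by positivity
    rw [norm_mul, norm_cpow_mul_exp _ _ hs0, norm_cpow_eq_rpow_re_of_pos h1, mul_assoc]
    gcongr
    have h2 : (1 + s / p) ^ (a - 1).re ≤ Real.exp s := by
      calc (1 + s / p) ^ (a - 1).re ≤ Real.exp (s / p) ^ (a - 1).re := by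
            have : 0 ≤ (a - 1).re := by simp; linarith
            gcongr
            linarith [Real.add_one_le_exp (s / p)]
        _ = Real.exp (s / p * (a - 1).re) := by rw [Real.exp_mul]
        _ ≤ Real.exp s := by
          rw [Real.exp_le_exp, div_mul_eq_mul_div, div_le_iff₀ hp]
          gcongr
          simpa using hpa
    calc _ ≤ Real.exp (-(2 * s)) * Real.exp s := by
          rw [show (2 : ℂ).re = 2 by simp]; gcongr
      _ = _ := by rw [← Real.exp_add]; congr 1; ring
  · refine Eventually.of_forall fun s => ?_
    have h1 : Tendsto (fun p : ℝ => ((1 + s / p : ℝ) : ℂ)) atTop (𝓝 1) := by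
      have h : Tendsto (fun p : ℝ => 1 + s / p) atTop (𝓝 (1 + 0)) :=
        tendsto_const_nhds.add (tendsto_id.const_div_atTop s)
      rw [add_zero] at h
      exact (continuous_ofReal.tendsto' 1 1 (by simp)).comp h
    have h2 : Tendsto (fun p : ℝ => ((1 + s / p : ℝ) : ℂ) ^ (a - 1)) atTop (𝓝 1) := by
      have := (continuousAt_cpow_const (b := a - 1) (a := 1) one_mem_slitPlane).tendsto.comp h1
      simpa [Function.comp_def] using this
    simpa using h2.const_mul ((s : ℂ) ^ (b - 1) * cexp (-(2 * s)))

theorem hasImagPowAsymptotics_of_one_lt_re {a b : ℂ} (ha : 1 < a.re) (hb : 0 < b.re) :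
    HasImagPowAsymptotics a b := by
  have hG : Complex.Gamma b ≠ 0 := Complex.Gamma_ne_zero_of_re_pos hb
  have h := (tendsto_integral_cpow_mul_one_add_div ha hb).const_mul
    (2 * Real.pi * (Complex.Gamma a)⁻¹ * (Complex.Gamma b)⁻¹)
  rw [HasImagPowAsymptotics]
  convert! h.congr' ?_ using 2
  · field_simp
  · filter_upwards [eventually_gt_atTop 0] with p hp
    rw [imagPowIntegral_eq_integral_Ioi ha hb hp, mul_assoc _ (integral _ _), ← integral_mul_const]
    congr 1
    refine setIntegral_congr_fun measurableSet_Ioi fun s hs => ?_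
    have hs0 : 0 < s := hs
    have hp0 : (p : ℂ) ≠ 0 := ofReal_ne_zero.2 hp.ne'
    have h1 : ((s + p : ℝ) : ℂ) ^ (a - 1) =
        (p : ℂ) ^ (a - 1) * ((1 + s / p : ℝ) : ℂ) ^ (a - 1) := by
      rw [← mul_cpow_ofReal_nonneg hp.le (by positivity), ← ofReal_mul]
      congr 2
      field_simp
      ring
    have h2 : (p : ℂ) ^ (a - 1) * (p : ℂ) ^ (1 - a) = 1 := by
      rw [← cpow_add _ _ hp0, show a - 1 + (1 - a) = 0 by ring, cpow_zero]
    have h3 : cexp (-(2 * s)) = cexp (-(2 * s + p)) * cexp p := by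
      rw [← Complex.exp_add]
      congr 1
      ring
    simp only [h1, h3]
    linear_combination (-(s : ℂ) ^ (b - 1) * ((1 + s / p : ℝ) : ℂ) ^ (a - 1) *
      (cexp (-(2 * s + p)) * cexp p)) * h2

theorem HasImagPowAsymptotics.of_add_one_left {a b : ℂ} (h : 1 < (a + b).re)
    (h₁ : HasImagPowAsymptotics (a + 1) b) (h₂ : HasImagPowAsymptotics (a + 1) (b + 1)) :
    HasImagPowAsymptotics a b := by
  have hlim := (h₁.const_mul (a + b)).sub (h₂.const_mul (2 * b))
  rw [HasImagPowAsymptotics]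
  convert! hlim.congr' ?_ using 2
  · rw [Complex.one_div_Gamma_eq_self_mul_one_div_Gamma_add_one a, neg_add,
      cpow_add _ _ two_ne_zero, cpow_neg_one]
    ring
  · filter_upwards [eventually_gt_atTop 0] with p hp
    have hp0 : (p : ℂ) ≠ 0 := ofReal_ne_zero.2 hp.ne'
    have e1 := mul_imagPowIntegral h p
    have e2 := imagPowIntegral_add_imagPowIntegral (show 0 < (a + b).re by linarith) p
    have e3 : (p : ℂ) ^ (1 - a) = (p : ℂ) ^ (1 - (a + 1)) * p := by
      rw [show 1 - a = 1 - (a + 1) + 1 by ring, cpow_add _ _ hp0, cpow_one]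
    rw [e3]
    linear_combination (-cexp p * (p : ℂ) ^ (1 - (a + 1))) * (e1 - b * e2)

theorem HasImagPowAsymptotics.of_add_one_right {a b : ℂ} (h : 1 < (a + b).re)
    (h₁ : HasImagPowAsymptotics a (b + 1)) (h₂ : HasImagPowAsymptotics (a - 1) (b + 1)) :
    HasImagPowAsymptotics a b := by
  have hinv : Tendsto (fun p : ℝ => (p : ℂ)⁻¹) atTop (𝓝 0) := by
    have := (continuous_ofReal.tendsto' 0 0 ofReal_zero).comp tendsto_inv_atTop_zero
    simpa [Function.comp_def] using this
  have hlim := (h₁.const_mul 2).sub (hinv.mul h₂)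
  rw [HasImagPowAsymptotics]
  convert! hlim.congr' ?_ using 2
  · rw [neg_add, cpow_add _ _ two_ne_zero, cpow_neg_one]
    ring
  · filter_upwards [eventually_gt_atTop 0] with p hp
    have hp0 : (p : ℂ) ≠ 0 := ofReal_ne_zero.2 hp.ne'
    have e2 := imagPowIntegral_add_imagPowIntegral (a := a - 1) (b := b)
      (by simp at h ⊢; linarith) p
    rw [sub_add_cancel] at e2
    have e3 : (p : ℂ)⁻¹ * (p : ℂ) ^ (1 - (a - 1)) = (p : ℂ) ^ (1 - a) := by
      rw [show 1 - (a - 1) = 1 - a + 1 by ring, cpow_add _ _ hp0, cpow_one]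
      field_simp
    linear_combination (-cexp p * (p : ℂ) ^ (1 - a)) * e2 -
      (imagPowIntegral (a - 1) (b + 1) p * cexp p) * e3

theorem hasImagPowAsymptotics_of_re_pos {a b : ℂ} (hb : 0 < b.re) (h : 1 < (a + b).re) :
    HasImagPowAsymptotics a b := by
  obtain ⟨n, hn⟩ := exists_nat_gt (1 - a.re)
  induction n generalizing a b with
  | zero => exact hasImagPowAsymptotics_of_one_lt_re (by simp at hn; linarith) hb
  | succ n ih =>
    push_cast at hn
    rw [add_re] at h
    refine .of_add_one_left (by simpa using h) (ih hb ?_ ?_) (ih ?_ ?_ ?_) <;>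
      simp <;> linarith

theorem hasImagPowAsymptotics {a b : ℂ} (h : 1 < (a + b).re) : HasImagPowAsymptotics a b := by
  obtain ⟨n, hn⟩ := exists_nat_gt (-b.re)
  induction n generalizing a b with
  | zero => exact hasImagPowAsymptotics_of_re_pos (by simp at hn; linarith) h
  | succ n ih =>
    push_cast at hn
    rw [add_re] at h
    refine .of_add_one_right (by simpa using h) (ih ?_ ?_) (ih ?_ ?_) <;>
      simp <;> linarith

end Asymptotics

section WhittakerFunction

theorem log_add_I (ξ : ℝ) : Complex.log (ξ + I) = Complex.log (1 - I * ξ) + Real.pi / 2 * I := by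
  have harg : |(1 - I * ξ : ℂ).arg| < Real.pi / 2 := abs_arg_lt_pi_div_two_iff.2 (Or.inl (by simp))
  rw [abs_lt] at harg
  have hpi := Real.pi_pos
  have h : (ξ + I : ℂ) = (1 - I * ξ) * I := by linear_combination (ξ : ℂ) * I_mul_I
  rw [h, Complex.log_mul (one_sub_I_mul_ne_zero ξ) I_ne_zero
    (by rw [arg_I]; constructor <;> linarith), log_I]

theorem log_sub_I (ξ : ℝ) : Complex.log (ξ - I) = Complex.log (1 + I * ξ) - Real.pi / 2 * I := by
  have harg : |(1 + I * ξ : ℂ).arg| < Real.pi / 2 := abs_arg_lt_pi_div_two_iff.2 (Or.inl (by simp))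
  rw [abs_lt] at harg
  have hpi := Real.pi_pos
  have h : (ξ - I : ℂ) = (1 + I * ξ) * (-I) := by linear_combination (ξ : ℂ) * I_mul_I
  rw [h, Complex.log_mul (one_add_I_mul_ne_zero ξ) (neg_ne_zero.2 I_ne_zero)
    (by rw [arg_neg_I]; constructor <;> linarith), log_neg_I]
  ring

theorem log_sq_add_one (ξ : ℝ) :
    Complex.log ((ξ ^ 2 + 1 : ℝ) : ℂ) = Complex.log (1 - I * ξ) + Complex.log (1 + I * ξ) := by
  have harg : |(1 + I * ξ : ℂ).arg| < Real.pi / 2 := abs_arg_lt_pi_div_two_iff.2 (Or.inl (by simp))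
  have harg' : |(1 - I * ξ : ℂ).arg| < Real.pi / 2 :=
    abs_arg_lt_pi_div_two_iff.2 (Or.inl (by simp))
  rw [abs_lt] at harg harg'
  rw [← Complex.log_mul (one_sub_I_mul_ne_zero ξ) (one_add_I_mul_ne_zero ξ)
    (by constructor <;> linarith)]
  congr 1
  push_cast
  linear_combination (ξ : ℂ) ^ 2 * I_mul_I

theorem Wh_eq_imagPowIntegral (μ ν : ℂ) (y : ℝ) :
    Wh μ ν y = Complex.Gamma (μ + ν + 1 / 2) / Real.pi * ((y / 4 : ℝ) : ℂ) ^ ((1 : ℂ) / 2 - ν) *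
      imagPowIntegral (μ + ν + 1 / 2) (ν + 1 / 2 - μ) (y / 2) := by
  have h_integrand : ∀ ξ : ℝ, cexp (-I * y * ξ / 2) * ((ξ ^ 2 + 1 : ℝ) : ℂ) ^ (-ν - 1 / 2) *
      cexp (μ * (Complex.log (ξ - I) - Complex.log (ξ + I))) =
      cexp (-(I * Real.pi * μ)) * (cexp (-(I * (y / 2 : ℝ) * ξ)) *
        imagPowKernel (μ + ν + 1 / 2) (ν + 1 / 2 - μ) ξ) := fun ξ => by
    have hne : ((ξ ^ 2 + 1 : ℝ) : ℂ) ≠ 0 := ofReal_ne_zero.2 (by positivity)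
    rw [imagPowKernel, cpow_def_of_ne_zero hne, cpow_def_of_ne_zero (one_sub_I_mul_ne_zero ξ),
      cpow_def_of_ne_zero (one_add_I_mul_ne_zero ξ), log_add_I, log_sub_I, log_sq_add_one]
    simp only [← Complex.exp_add]
    congr 1
    push_cast
    ring
  have he : cexp (I * Real.pi * μ) * cexp (-(I * Real.pi * μ)) = 1 := by
    rw [← Complex.exp_add, add_neg_cancel, Complex.exp_zero]
  rw [Wh, integral_congr_ae (Eventually.of_forall h_integrand), integral_const_mul, ← imagPowIntegral]
  linear_combination (Complex.Gamma (μ + ν + 1 / 2) / Real.pi *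
    ((y / 4 : ℝ) : ℂ) ^ ((1 : ℂ) / 2 - ν) *
      imagPowIntegral (μ + ν + 1 / 2) (ν + 1 / 2 - μ) (y / 2)) * he

end WhittakerFunction

/-- Large-argument asymptotics of the Whittaker function:
W_{μ,ν}(y) / (y^μ e^{−y/2}) → 1 as y → +∞. -/
theorem whittaker_asymptotics (μ ν : ℂ) (hν : 0 < ν.re)
    (hpole : ∀ n : ℕ, μ + ν + 1 / 2 ≠ -(n : ℂ)) :
    Filter.Tendsto (fun y : ℝ => Wh μ ν y / ((y : ℂ) ^ μ * Complex.exp (-(y : ℂ) / 2)))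
      Filter.atTop (nhds 1) := by
  have hG : Complex.Gamma (μ + ν + 1 / 2) ≠ 0 := Complex.Gamma_ne_zero hpole
  have hpi : (Real.pi : ℂ) ≠ 0 := ofReal_ne_zero.2 Real.pi_ne_zero
  have h := hasImagPowAsymptotics (a := μ + ν + 1 / 2) (b := ν + 1 / 2 - μ) (by
    rw [show μ + ν + 1 / 2 + (ν + 1 / 2 - μ) = 2 * ν + 1 by ring]
    simpa using hν)
  rw [HasImagPowAsymptotics] at h
  have h' := (h.comp (tendsto_id.atTop_div_const (two_pos (α := ℝ)))).const_mul
    (Complex.Gamma (μ + ν + 1 / 2) / Real.pi * 2 ^ (ν - 1 / 2 - μ))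
  convert! h'.congr' ?_ using 2
  · have h2 : (2 : ℂ) ^ (ν - 1 / 2 - μ) * 2 ^ (-(ν + 1 / 2 - μ)) = 2⁻¹ := by
      rw [← cpow_add _ _ two_ne_zero, ← cpow_neg_one]
      congr 1
      ring
    generalize (2 : ℂ) ^ (ν - 1 / 2 - μ) = u at h2 ⊢
    generalize (2 : ℂ) ^ (-(ν + 1 / 2 - μ)) = v at h2 ⊢
    generalize Complex.Gamma (μ + ν + 1 / 2) = g at hG ⊢
    field_simp
    linear_combination -2 * h2
  · filter_upwards [eventually_gt_atTop 0] with y hy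
    set p : ℝ := y / 2 with hp
    have hp0 : 0 < p := by positivity
    have hpc : (p : ℂ) ≠ 0 := ofReal_ne_zero.2 hp0.ne'
    have hy2 : y = 2 * p := by rw [hp]; ring
    have e1 : ((y / 4 : ℝ) : ℂ) ^ ((1 : ℂ) / 2 - ν) =
        2 ^ (ν - 1 / 2) * (p : ℂ) ^ ((1 : ℂ) / 2 - ν) := by
      have h2 : ((2⁻¹ : ℝ) : ℂ) ^ ((1 : ℂ) / 2 - ν) = 2 ^ (ν - 1 / 2) := by
        rw [ofReal_inv, ofReal_ofNat, inv_cpow _ _ (by simpa using Real.pi_ne_zero.symm),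
          ← cpow_neg, neg_sub]
      rw [← h2, ← mul_cpow_ofReal_nonneg (by positivity) hp0.le, ← ofReal_mul]
      congr 2
      rw [hp]
      ring
    have e2 : (y : ℂ) ^ μ = 2 ^ μ * (p : ℂ) ^ μ := by
      rw [← ofReal_ofNat, ← mul_cpow_ofReal_nonneg (by positivity) hp0.le, ← ofReal_mul, hy2]
    have e3 : cexp (-(y : ℂ) / 2) = (cexp p)⁻¹ := by
      rw [← Complex.exp_neg, hp]
      congr 1
      push_cast
      ring
    have e4 : (p : ℂ) ^ (1 - (μ + ν + 1 / 2)) = (p : ℂ) ^ ((1 : ℂ) / 2 - ν) / (p : ℂ) ^ μ := by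
      rw [← cpow_sub _ _ hpc]
      congr 1
      ring
    rw [Function.comp_apply, id, ← hp, Wh_eq_imagPowIntegral, e1, e2, e3, e4, ← hp,
      cpow_sub _ μ two_ne_zero]
    field_simp
end

section
/- Recurrence relations and the Whittaker differential equation: let μ, ν ∈ ℂ with Re ν > 0 and with μ + ν + 1/2 + k not a nonpositive integer for each k ∈ {−1, 0, 1}. Then for all y > 0: (a) y·W′_{μ,ν}(y) − (y/2)·W_{μ,ν}(y) + μ·W_{μ,ν}(y) = −W_{μ+1,ν}(y); (b) y·W′_{μ,ν}(y) + (y/2)·W_{μ,ν}(y) − μ·W_{μ,ν}(y) = ((μ−1/2)² − ν²)·W_{μ−1,ν}(y); (c) −W″_{μ,ν}(y) + (1/4 − μ/y + (ν² − 1/4)/y²)·W_{μ,ν}(y) = 0, where ′ denotes differentiation in y (in particular y ↦ W_{μ,ν}(y) is twice differentiable on (0,∞)). -/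
open MeasureTheory

/-- The amplitude of the integrand of `Wh`, that is, the integrand without its oscillating factor. -/
noncomputable def whAmp (μ ν : ℂ) (ξ : ℝ) : ℂ :=
  ((ξ ^ 2 + 1 : ℝ) : ℂ) ^ (-ν - 1 / 2) *
    Complex.exp (μ * (Complex.log ((ξ : ℂ) - Complex.I) - Complex.log ((ξ : ℂ) + Complex.I)))

/-- The derivative of `whAmp μ ν`. -/
noncomputable def whAmpDeriv (μ ν : ℂ) (ξ : ℝ) : ℂ :=
  (2 * Complex.I * μ - (2 * ν + 1) * ξ) / ((ξ : ℂ) ^ 2 + 1) * whAmp μ ν ξ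

/-- The oscillating factor of the integrand of `Wh`. -/
noncomputable def whOsc (y ξ : ℝ) : ℂ :=
  Complex.exp (-Complex.I * (y : ℂ) * (ξ : ℂ) / 2)

/-- The integral in the definition of `Wh`. -/
noncomputable def whInt (μ ν : ℂ) (y : ℝ) : ℂ :=
  ∫ ξ : ℝ, whOsc y ξ * whAmp μ ν ξ

theorem wh_eq (μ ν : ℂ) (y : ℝ) :
    Wh μ ν y = Complex.exp (Complex.I * (Real.pi : ℂ) * μ) * Complex.Gamma (μ + ν + 1 / 2) /
      (Real.pi : ℂ) * ((y / 4 : ℝ) : ℂ) ^ ((1 : ℂ) / 2 - ν) * whInt μ ν y := by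
  simp only [Wh, whInt, whOsc, whAmp, mul_assoc]

theorem ofReal_sub_I_ne_zero (ξ : ℝ) : (ξ : ℂ) - Complex.I ≠ 0 := fun h => by
  simpa using congrArg Complex.im h

theorem ofReal_add_I_ne_zero (ξ : ℝ) : (ξ : ℂ) + Complex.I ≠ 0 := fun h => by
  simpa using congrArg Complex.im h

theorem ofReal_sq_add_one_eq (ξ : ℝ) :
    (ξ : ℂ) ^ 2 + 1 = ((ξ : ℂ) - Complex.I) * ((ξ : ℂ) + Complex.I) := by
  linear_combination Complex.I_sq

theorem ofReal_sq_add_one_ne_zero (ξ : ℝ) : (ξ : ℂ) ^ 2 + 1 ≠ 0 := by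
  rw [ofReal_sq_add_one_eq]
  exact mul_ne_zero (ofReal_sub_I_ne_zero ξ) (ofReal_add_I_ne_zero ξ)

theorem norm_whOsc (y ξ : ℝ) : ‖whOsc y ξ‖ = 1 := by
  rw [whOsc, Complex.norm_exp]
  simp

theorem hasDerivAt_whOsc_left (y ξ : ℝ) :
    HasDerivAt (fun s : ℝ => whOsc s ξ) (-Complex.I / 2 * ξ * whOsc y ξ) y := by
  have h := ((((hasDerivAt_id (y : ℂ)).const_mul (-Complex.I)).mul_const (ξ : ℂ)).div_const
    2).cexp.comp_ofReal
  refine h.congr_deriv ?_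
  simp only [whOsc, id]
  ring

theorem hasDerivAt_whOsc_right (y ξ : ℝ) :
    HasDerivAt (whOsc y) (-Complex.I / 2 * y * whOsc y ξ) ξ := by
  have h := (((hasDerivAt_id (ξ : ℂ)).const_mul (-Complex.I * (y : ℂ))).div_const
    2).cexp.comp_ofReal
  refine h.congr_deriv ?_
  simp only [whOsc, id]
  ring

theorem continuous_whOsc (y : ℝ) : Continuous (whOsc y) :=
  continuous_iff_continuousAt.2 fun ξ => (hasDerivAt_whOsc_right y ξ).continuousAt

theorem hasDerivAt_whAmp (μ ν : ℂ) (ξ : ℝ) :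
    HasDerivAt (whAmp μ ν) (whAmpDeriv μ ν ξ) ξ := by
  have hm := ofReal_sub_I_ne_zero ξ
  have hp := ofReal_add_I_ne_zero ξ
  have hq := ofReal_sq_add_one_ne_zero ξ
  have hpos : 0 < ξ ^ 2 + 1 := by positivity
  have hcast : (((ξ ^ 2 + 1 : ℝ)) : ℂ) = (ξ : ℂ) ^ 2 + 1 := by push_cast; ring
  have hmem : (ξ : ℂ) ^ 2 + 1 ∈ Complex.slitPlane := by
    rw [← hcast]
    exact Complex.ofReal_mem_slitPlane.2 hpos
  have h1 : HasDerivAt (fun z : ℂ => (z ^ 2 + 1) ^ (-ν - 1 / 2))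
      ((-ν - 1 / 2) * ((ξ : ℂ) ^ 2 + 1) ^ (-ν - 1 / 2 - 1) * (2 * ξ)) (ξ : ℂ) := by
    have h := (((hasDerivAt_id (ξ : ℂ)).pow 2).add_const 1).cpow_const (c := -ν - 1 / 2)
      hmem
    refine h.congr_deriv ?_
    simp
  have h2 : HasDerivAt (fun z : ℂ => Complex.exp (μ * (Complex.log (z - Complex.I) -
      Complex.log (z + Complex.I)))) _ (ξ : ℂ) :=
    (((((hasDerivAt_id (ξ : ℂ)).sub_const Complex.I).clog (Or.inr (by simp))).sub
      (((hasDerivAt_id (ξ : ℂ)).add_const Complex.I).clog (Or.inr (by simp)))).const_mul μ).cexp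
  have h := (h1.mul h2).comp_ofReal
  have hfun : whAmp μ ν = fun x : ℝ => ((x : ℂ) ^ 2 + 1) ^ (-ν - 1 / 2) *
      Complex.exp (μ * (Complex.log ((x : ℂ) - Complex.I) -
        Complex.log ((x : ℂ) + Complex.I))) := by
    funext x
    simp [whAmp]
  rw [hfun]
  refine h.congr_deriv ?_
  rw [whAmpDeriv, hfun, Complex.cpow_sub _ _ hq, Complex.cpow_one]
  simp only [id, Pi.sub_apply]
  rw [ofReal_sq_add_one_eq] at *
  field_simp
  ring

theorem continuous_whAmp (μ ν : ℂ) : Continuous (whAmp μ ν) :=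
  continuous_iff_continuousAt.2 fun ξ => (hasDerivAt_whAmp μ ν ξ).continuousAt

theorem norm_log_sub_log_le (ξ : ℝ) :
    ‖Complex.log ((ξ : ℂ) - Complex.I) - Complex.log ((ξ : ℂ) + Complex.I)‖ ≤ 2 * Real.pi := by
  refine (Complex.norm_le_abs_re_add_abs_im _).trans ?_
  have hn : ‖(ξ : ℂ) - Complex.I‖ = ‖(ξ : ℂ) + Complex.I‖ := by
    rw [← Complex.norm_conj]
    simp
  have hm := Complex.abs_arg_le_pi ((ξ : ℂ) - Complex.I)
  have hp := Complex.abs_arg_le_pi ((ξ : ℂ) + Complex.I)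
  have := abs_sub (Complex.arg ((ξ : ℂ) - Complex.I)) (Complex.arg ((ξ : ℂ) + Complex.I))
  simp only [Complex.sub_re, Complex.log_re, hn, sub_self, abs_zero, Complex.sub_im,
    Complex.log_im]
  linarith

theorem norm_whAmp_le (μ ν : ℂ) (ξ : ℝ) :
    ‖whAmp μ ν ξ‖ ≤ Real.exp (‖μ‖ * (2 * Real.pi)) * (1 + ‖ξ‖ ^ 2) ^ (-(2 * ν.re + 1) / 2) := by
  have hpos : 0 < ξ ^ 2 + 1 := by positivity
  rw [whAmp, norm_mul, Complex.norm_cpow_eq_rpow_re_of_pos hpos, mul_comm]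
  refine mul_le_mul ?_ (le_of_eq ?_) (by positivity) (by positivity)
  · refine (Complex.norm_exp_le_exp_norm _).trans (Real.exp_le_exp.2 ?_)
    rw [norm_mul]
    exact mul_le_mul_of_nonneg_left (norm_log_sub_log_le ξ) (norm_nonneg _)
  · rw [Real.norm_eq_abs, sq_abs, add_comm]
    congr 1
    simp
    ring

theorem integrable_whAmp (μ : ℂ) {ν : ℂ} (hν : 0 < ν.re) : Integrable (whAmp μ ν) := by
  have h : Integrable (fun ξ : ℝ => (1 + ‖ξ‖ ^ 2) ^ (-(2 * ν.re + 1) / 2)) :=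
    integrable_rpow_neg_one_add_norm_sq (by simpa using hν)
  exact (h.const_mul _).mono' (continuous_whAmp μ ν).aestronglyMeasurable
    (.of_forall (norm_whAmp_le μ ν))

theorem continuous_whAmpDeriv (μ ν : ℂ) : Continuous (whAmpDeriv μ ν) := by
  unfold whAmpDeriv
  exact (Continuous.div (by fun_prop) (by fun_prop) ofReal_sq_add_one_ne_zero).mul
    (continuous_whAmp μ ν)

theorem norm_whAmpDeriv_mul_le (μ ν : ℂ) (ξ : ℝ) :
    ‖whAmpDeriv μ ν ξ‖ * (1 + |ξ|) ≤ 2 * (2 * ‖μ‖ + ‖2 * ν + 1‖) * ‖whAmp μ ν ξ‖ := by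
  have hpos : 0 < ξ ^ 2 + 1 := by positivity
  have hden : ‖(ξ : ℂ) ^ 2 + 1‖ = ξ ^ 2 + 1 := by
    rw [show (ξ : ℂ) ^ 2 + 1 = ((ξ ^ 2 + 1 : ℝ) : ℂ) by push_cast; rfl, Complex.norm_real,
      Real.norm_eq_abs, abs_of_pos hpos]
  have hnum : ‖2 * Complex.I * μ - (2 * ν + 1) * ξ‖ ≤ (2 * ‖μ‖ + ‖2 * ν + 1‖) * (1 + |ξ|) := by
    refine (norm_sub_le _ _).trans ?_
    simp only [norm_mul, Complex.norm_ofNat, Complex.norm_I, Complex.norm_real, Real.norm_eq_abs]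
    nlinarith [norm_nonneg μ, norm_nonneg (2 * ν + 1), abs_nonneg ξ,
      mul_nonneg (norm_nonneg μ) (abs_nonneg ξ)]
  rw [whAmpDeriv, norm_mul, norm_div, hden, mul_right_comm]
  refine mul_le_mul_of_nonneg_right ?_ (norm_nonneg _)
  rw [div_mul_eq_mul_div, div_le_iff₀ hpos]
  have hsq : (1 + |ξ|) * (1 + |ξ|) ≤ 2 * (ξ ^ 2 + 1) := by
    nlinarith [sq_nonneg (|ξ| - 1), sq_abs ξ]
  calc _ ≤ (2 * ‖μ‖ + ‖2 * ν + 1‖) * (1 + |ξ|) * (1 + |ξ|) := by gcongr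
    _ = (2 * ‖μ‖ + ‖2 * ν + 1‖) * ((1 + |ξ|) * (1 + |ξ|)) := by ring
    _ ≤ (2 * ‖μ‖ + ‖2 * ν + 1‖) * (2 * (ξ ^ 2 + 1)) := by gcongr
    _ = _ := by ring

theorem integrable_whAmpDeriv (μ : ℂ) {ν : ℂ} (hν : 0 < ν.re) : Integrable (whAmpDeriv μ ν) := by
  refine ((integrable_whAmp μ hν).norm.const_mul (2 * (2 * ‖μ‖ + ‖2 * ν + 1‖))).mono'
    (continuous_whAmpDeriv μ ν).aestronglyMeasurable (.of_forall fun ξ => ?_)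
  refine le_trans ?_ (norm_whAmpDeriv_mul_le μ ν ξ)
  exact le_mul_of_one_le_right (norm_nonneg _) (by linarith [abs_nonneg ξ])

theorem integrable_mul_whAmpDeriv (μ : ℂ) {ν : ℂ} (hν : 0 < ν.re) :
    Integrable (fun ξ : ℝ => (ξ : ℂ) * whAmpDeriv μ ν ξ) := by
  refine ((integrable_whAmp μ hν).norm.const_mul (2 * (2 * ‖μ‖ + ‖2 * ν + 1‖))).mono'
    (Complex.continuous_ofReal.mul (continuous_whAmpDeriv μ ν)).aestronglyMeasurable
    (.of_forall fun ξ => ?_)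
  refine le_trans ?_ (norm_whAmpDeriv_mul_le μ ν ξ)
  rw [norm_mul, mul_comm, Complex.norm_real, Real.norm_eq_abs]
  exact mul_le_mul_of_nonneg_left (by linarith) (norm_nonneg _)

theorem MeasureTheory.Integrable.whOsc_mul {f : ℝ → ℂ} (hf : Integrable f) (y : ℝ) :
    Integrable (fun ξ => whOsc y ξ * f ξ) :=
  hf.bdd_mul (continuous_whOsc y).aestronglyMeasurable
    (.of_forall fun ξ => (norm_whOsc y ξ).le)

/-- Integration by parts. -/
theorem whInt_eq_integral_whAmpDeriv (μ : ℂ) {ν : ℂ} (hν : 0 < ν.re) (y : ℝ) :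
    Complex.I / 2 * y * whInt μ ν y = ∫ ξ : ℝ, whOsc y ξ * whAmpDeriv μ ν ξ := by
  have hA := (integrable_whAmp μ hν).whOsc_mul y
  have hD := (integrable_whAmpDeriv μ hν).whOsc_mul y
  have hA' := hA.const_mul (-Complex.I / 2 * y)
  have h := integral_eq_zero_of_hasDerivAt_of_integrable
    (f' := fun ξ : ℝ => -Complex.I / 2 * y * (whOsc y ξ * whAmp μ ν ξ) +
      whOsc y ξ * whAmpDeriv μ ν ξ)
    (fun ξ => ((hasDerivAt_whOsc_right y ξ).mul (hasDerivAt_whAmp μ ν ξ)).congr_deriv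
      (by ring)) (hA'.add hD) hA
  rw [integral_add hA' hD, integral_const_mul] at h
  rw [whInt]
  linear_combination -h

theorem hasDerivAt_integral_whAmpDeriv (μ : ℂ) {ν : ℂ} (hν : 0 < ν.re) (y : ℝ) :
    HasDerivAt (fun s : ℝ => ∫ ξ : ℝ, whOsc s ξ * whAmpDeriv μ ν ξ)
      (-Complex.I / 2 * ∫ ξ : ℝ, whOsc y ξ * (ξ * whAmpDeriv μ ν ξ)) y := by
  rw [← integral_const_mul]
  refine (hasDerivAt_integral_of_dominated_loc_of_deriv_le (μ := volume)
    (F := fun s (ξ : ℝ) => whOsc s ξ * whAmpDeriv μ ν ξ)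
    (F' := fun s (ξ : ℝ) => -Complex.I / 2 * (whOsc s ξ * (ξ * whAmpDeriv μ ν ξ)))
    (bound := fun ξ : ℝ => 1 / 2 * ‖(ξ : ℂ) * whAmpDeriv μ ν ξ‖) Filter.univ_mem
    (.of_forall fun s => ((integrable_whAmpDeriv μ hν).whOsc_mul s).aestronglyMeasurable)
    ((integrable_whAmpDeriv μ hν).whOsc_mul y)
    (((integrable_mul_whAmpDeriv μ hν).whOsc_mul y).const_mul _).aestronglyMeasurable
    (.of_forall fun ξ s _ => ?_)
    ((integrable_mul_whAmpDeriv μ hν).norm.const_mul _)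
    (.of_forall fun ξ s _ => ?_)).2
  · rw [norm_mul, norm_mul (whOsc s ξ), norm_whOsc]
    simp
  · exact ((hasDerivAt_whOsc_left s ξ).mul_const _).congr_deriv (by ring)

theorem hasDerivAt_whInt (μ : ℂ) {ν : ℂ} (hν : 0 < ν.re) {y : ℝ} (hy : 0 < y) :
    HasDerivAt (whInt μ ν)
      ((-whInt μ ν y - ∫ ξ : ℝ, whOsc y ξ * (ξ * whAmpDeriv μ ν ξ)) / y) y := by
  have hy0 : (y : ℂ) ≠ 0 := by exact_mod_cast hy.ne'
  have hJ := whInt_eq_integral_whAmpDeriv μ hν y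
  have h := ((hasDerivAt_integral_whAmpDeriv μ hν y).const_mul (-2 * Complex.I)).div
    (hasDerivAt_id (y : ℂ)).comp_ofReal hy0
  refine (h.congr_deriv ?_).congr_of_eventuallyEq ?_
  · simp only [id]
    rw [← hJ]
    generalize (∫ ξ : ℝ, whOsc y ξ * (ξ * whAmpDeriv μ ν ξ)) = K
    field_simp
    linear_combination (whInt μ ν y + K) * Complex.I_sq
  · filter_upwards [eventually_gt_nhds hy] with s hs
    have hs0 : (s : ℂ) ≠ 0 := by exact_mod_cast hs.ne'
    simp only [id, Pi.div_apply]
    rw [← whInt_eq_integral_whAmpDeriv μ hν s]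
    field_simp
    linear_combination whInt μ ν s * Complex.I_sq

theorem whAmp_add_one (μ ν : ℂ) (ξ : ℝ) :
    whAmp (μ + 1) ν ξ = whAmp μ ν ξ * (((ξ : ℂ) - Complex.I) / ((ξ : ℂ) + Complex.I)) := by
  rw [whAmp, whAmp, add_mul, one_mul, Complex.exp_add, Complex.exp_sub,
    Complex.exp_log (ofReal_sub_I_ne_zero ξ), Complex.exp_log (ofReal_add_I_ne_zero ξ), mul_assoc]

theorem whInt_add_one (μ : ℂ) {ν : ℂ} (hν : 0 < ν.re) (y : ℝ) :
    (μ + ν + 1 / 2) * whInt (μ + 1) ν y = (μ - ν - 1 / 2) * whInt μ ν y -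
      (∫ ξ : ℝ, whOsc y ξ * (ξ * whAmpDeriv μ ν ξ)) - y / 2 * whInt μ ν y := by
  have hA := (integrable_whAmp μ hν).whOsc_mul y
  have hD := (integrable_whAmpDeriv μ hν).whOsc_mul y
  have hK := (integrable_mul_whAmpDeriv μ hν).whOsc_mul y
  have hJ := whInt_eq_integral_whAmpDeriv μ hν y
  have key : (μ + ν + 1 / 2) * whInt (μ + 1) ν y = (μ - ν - 1 / 2) * whInt μ ν y -
      (∫ ξ : ℝ, whOsc y ξ * (ξ * whAmpDeriv μ ν ξ)) +
      Complex.I * ∫ ξ : ℝ, whOsc y ξ * whAmpDeriv μ ν ξ := by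
    simp only [whInt]
    rw [← integral_const_mul, ← integral_const_mul, ← integral_const_mul,
      ← integral_sub (hA.const_mul _) hK,
      ← integral_add (by exact (hA.const_mul _).sub hK) (hD.const_mul _)]
    congr 1
    funext ξ
    have hm := ofReal_sub_I_ne_zero ξ
    have hp := ofReal_add_I_ne_zero ξ
    simp only [whAmp_add_one, whAmpDeriv, ofReal_sq_add_one_eq]
    field_simp
    ring
  rw [key, ← hJ]
  linear_combination (y / 2 * whInt μ ν y) * Complex.I_sq

theorem whInt_sub_one (μ : ℂ) {ν : ℂ} (hν : 0 < ν.re) (y : ℝ) :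
    (ν + 1 / 2 - μ) * whInt (μ - 1) ν y = -(μ + ν + 1 / 2) * whInt μ ν y -
      (∫ ξ : ℝ, whOsc y ξ * (ξ * whAmpDeriv μ ν ξ)) + y / 2 * whInt μ ν y := by
  have hA := (integrable_whAmp μ hν).whOsc_mul y
  have hD := (integrable_whAmpDeriv μ hν).whOsc_mul y
  have hK := (integrable_mul_whAmpDeriv μ hν).whOsc_mul y
  have hJ := whInt_eq_integral_whAmpDeriv μ hν y
  have key : (ν + 1 / 2 - μ) * whInt (μ - 1) ν y = -(μ + ν + 1 / 2) * whInt μ ν y -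
      (∫ ξ : ℝ, whOsc y ξ * (ξ * whAmpDeriv μ ν ξ)) -
      Complex.I * ∫ ξ : ℝ, whOsc y ξ * whAmpDeriv μ ν ξ := by
    simp only [whInt]
    rw [← integral_const_mul, ← integral_const_mul, ← integral_const_mul,
      ← integral_sub (hA.const_mul _) hK,
      ← integral_sub (by exact (hA.const_mul _).sub hK) (hD.const_mul _)]
    congr 1
    funext ξ
    have hm := ofReal_sub_I_ne_zero ξ
    have hp := ofReal_add_I_ne_zero ξ
    have hA1 : whAmp μ ν ξ =
        whAmp (μ - 1) ν ξ * (((ξ : ℂ) - Complex.I) / ((ξ : ℂ) + Complex.I)) := by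
      rw [← whAmp_add_one, sub_add_cancel]
    simp only [whAmpDeriv, hA1, ofReal_sq_add_one_eq]
    field_simp
    ring
  rw [key, ← hJ]
  linear_combination (-(y / 2 * whInt μ ν y)) * Complex.I_sq

theorem hasDerivAt_wh (μ : ℂ) {ν : ℂ} (hν : 0 < ν.re) {y : ℝ} (hy : 0 < y) :
    HasDerivAt (Wh μ ν)
      (Complex.exp (Complex.I * (Real.pi : ℂ) * μ) * Complex.Gamma (μ + ν + 1 / 2) /
        (Real.pi : ℂ) * ((y / 4 : ℝ) : ℂ) ^ ((1 : ℂ) / 2 - ν) *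
        ((-(ν + 1 / 2) * whInt μ ν y - ∫ ξ : ℝ, whOsc y ξ * (ξ * whAmpDeriv μ ν ξ)) / y)) y := by
  have hy0 : (y : ℂ) ≠ 0 := by exact_mod_cast hy.ne'
  have hy4 : (y : ℂ) / 4 ≠ 0 := div_ne_zero hy0 (by norm_num)
  have hcast : ∀ s : ℝ, ((s / 4 : ℝ) : ℂ) = (s : ℂ) / 4 := fun s => by push_cast; rfl
  have hslit : (y : ℂ) / 4 ∈ Complex.slitPlane := by
    rw [← hcast]
    exact Complex.ofReal_mem_slitPlane.2 (by positivity)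
  have h1 := (((hasDerivAt_id (y : ℂ)).div_const 4).cpow_const (c := 1 / 2 - ν)
    hslit).comp_ofReal
  have h := (h1.const_mul (Complex.exp (Complex.I * (Real.pi : ℂ) * μ) *
    Complex.Gamma (μ + ν + 1 / 2) / (Real.pi : ℂ))).mul (hasDerivAt_whInt μ hν hy)
  refine (h.congr_of_eventuallyEq (.of_forall fun s => ?_)).congr_deriv ?_
  · simp only [wh_eq, hcast, id, Pi.mul_apply]
  · rw [hcast]
    simp only [id]
    rw [Complex.cpow_sub _ _ hy4, Complex.cpow_one]
    field_simp
    ring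

/-- The Gamma factor and the exponential factor of `Wh` under `μ ↦ μ + 1`. -/
theorem exp_mul_gamma_add_one {μ ν : ℂ} (h : μ + ν + 1 / 2 ≠ 0) :
    Complex.exp (Complex.I * (Real.pi : ℂ) * (μ + 1)) * Complex.Gamma (μ + 1 + ν + 1 / 2) =
      -(Complex.exp (Complex.I * (Real.pi : ℂ) * μ) *
        ((μ + ν + 1 / 2) * Complex.Gamma (μ + ν + 1 / 2))) := by
  rw [show μ + 1 + ν + 1 / 2 = μ + ν + 1 / 2 + 1 by ring, Complex.Gamma_add_one _ h, mul_add,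
    Complex.exp_add, mul_one, mul_comm Complex.I, Complex.exp_pi_mul_I]
  ring

theorem hasDerivAt_wh_add_one {μ ν : ℂ} (hν : 0 < ν.re) (h : μ + ν + 1 / 2 ≠ 0) {y : ℝ}
    (hy : 0 < y) :
    HasDerivAt (Wh μ ν) ((((y : ℂ) / 2 - μ) * Wh μ ν y - Wh (μ + 1) ν y) / y) y := by
  refine (hasDerivAt_wh μ hν hy).congr_deriv ?_
  have hy0 : (y : ℂ) ≠ 0 := by exact_mod_cast hy.ne'
  have hpi : (Real.pi : ℂ) ≠ 0 := by exact_mod_cast Real.pi_ne_zero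
  rw [wh_eq, wh_eq (μ + 1), exp_mul_gamma_add_one h]
  have key := whInt_add_one μ hν y
  generalize ((y / 4 : ℝ) : ℂ) ^ ((1 : ℂ) / 2 - ν) = P
  generalize (∫ ξ : ℝ, whOsc y ξ * (ξ * whAmpDeriv μ ν ξ)) = K at *
  generalize Complex.Gamma (μ + ν + 1 / 2) = G
  generalize Complex.exp (Complex.I * (Real.pi : ℂ) * μ) = E
  rw [eq_div_iff hy0]
  field_simp
  linear_combination (-2 * E * P * G) * key

theorem hasDerivAt_wh_sub_one {μ ν : ℂ} (hν : 0 < ν.re) (h : μ + ν - 1 / 2 ≠ 0) {y : ℝ}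
    (hy : 0 < y) :
    HasDerivAt (Wh μ ν)
      (((μ - (y : ℂ) / 2) * Wh μ ν y + ((μ - 1 / 2) ^ 2 - ν ^ 2) * Wh (μ - 1) ν y) / y) y := by
  refine (hasDerivAt_wh μ hν hy).congr_deriv ?_
  have hy0 : (y : ℂ) ≠ 0 := by exact_mod_cast hy.ne'
  have hpi : (Real.pi : ℂ) ≠ 0 := by exact_mod_cast Real.pi_ne_zero
  have hG := exp_mul_gamma_add_one (μ := μ - 1) (ν := ν) (by convert h using 1; ring)
  rw [sub_add_cancel] at hG
  rw [wh_eq, wh_eq (μ - 1), hG]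
  have key := whInt_sub_one μ hν y
  generalize ((y / 4 : ℝ) : ℂ) ^ ((1 : ℂ) / 2 - ν) = P
  generalize (∫ ξ : ℝ, whOsc y ξ * (ξ * whAmpDeriv μ ν ξ)) = K at *
  generalize Complex.Gamma (μ - 1 + ν + 1 / 2) = G
  generalize Complex.exp (Complex.I * (Real.pi : ℂ) * (μ - 1)) = E
  rw [eq_div_iff hy0]
  field_simp
  linear_combination (4 * E * P * G * (μ - 1 + ν + 1 / 2)) * key

/-- Recurrence relations and the Whittaker differential equation. -/
theorem whittaker_recurrence_and_ode (μ ν : ℂ) (hν : 0 < ν.re)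
    (hpole : ∀ k : ℤ, (k = -1 ∨ k = 0 ∨ k = 1) → ∀ n : ℕ, μ + ν + 1 / 2 + (k : ℂ) ≠ -(n : ℂ)) :
    ∃ W' W'' : ℝ → ℂ,
      (∀ y : ℝ, 0 < y → HasDerivAt (fun s : ℝ => Wh μ ν s) (W' y) y) ∧
      (∀ y : ℝ, 0 < y → HasDerivAt W' (W'' y) y) ∧
      (∀ y : ℝ, 0 < y →
        ((y : ℂ) * W' y - (y : ℂ) / 2 * Wh μ ν y + μ * Wh μ ν y = -Wh (μ + 1) ν y) ∧
        ((y : ℂ) * W' y + (y : ℂ) / 2 * Wh μ ν y - μ * Wh μ ν y =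
          ((μ - 1 / 2) ^ 2 - ν ^ 2) * Wh (μ - 1) ν y) ∧
        (-W'' y + (1 / 4 - μ / (y : ℂ) + (ν ^ 2 - 1 / 4) / (y : ℂ) ^ 2) * Wh μ ν y = 0)) := by
  have h0 : μ + ν + 1 / 2 ≠ 0 := by simpa using hpole 0 (by simp) 0
  have h1 : μ + ν - 1 / 2 ≠ 0 := by
    have h := hpole (-1) (by simp) 0
    intro h'
    apply h
    push_cast
    linear_combination h'
  have hd := fun (y : ℝ) (hy : 0 < y) => hasDerivAt_wh_add_one hν h0 hy
  have hd' := fun (y : ℝ) (hy : 0 < y) => hasDerivAt_wh_sub_one hν h1 hy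
  have hd1 := fun (y : ℝ) (hy : 0 < y) => hasDerivAt_wh_sub_one (μ := μ + 1) hν
    (by convert h0 using 1; ring) hy
  simp only [add_sub_cancel_right] at hd1
  refine ⟨fun y => (((y : ℂ) / 2 - μ) * Wh μ ν y - Wh (μ + 1) ν y) / y,
    fun y => (1 / 4 - μ / (y : ℂ) + (ν ^ 2 - 1 / 4) / (y : ℂ) ^ 2) * Wh μ ν y,
    hd, fun y hy => ?_, fun y hy => ⟨?_, ?_, by ring⟩⟩
  · have hy0 : (y : ℂ) ≠ 0 := by exact_mod_cast hy.ne'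
    have hid := (hasDerivAt_id (y : ℂ)).comp_ofReal
    refine ((((((hid.div_const 2).sub_const μ).mul (hd y hy)).sub (hd1 y hy)).div hid
      hy0)).congr_deriv ?_
    simp only [id, Pi.mul_apply, Pi.sub_apply]
    field_simp
    ring
  · have hy0 : (y : ℂ) ≠ 0 := by exact_mod_cast hy.ne'
    field_simp
    ring
  · have hy0 : (y : ℂ) ≠ 0 := by exact_mod_cast hy.ne'
    beta_reduce
    rw [(hd y hy).unique (hd' y hy)]
    field_simp
    ring
end
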